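/- arXiv:2603.01501 — 3 statements merged into one kernel-verified Lean document; each statement's English description precedes it below -/
import Mathlib

section
/- Fix t ≥ 1, a stepsize η_{t−1} > 0, and λ_t > 0. Let ĝ_{t−1} be the previous stochastic gradient, u_{t−1} = ĝ_{t−1}/‖ĝ_{t−1}‖ when ĝ_{t−1} ≠ 0 and u_{t−1} = 0 otherwise, and P⊥_{t−1} = I − u_{t−1}u_{t−1}ᵀ. Suppose almost surely b_t = η_{t−1} B_t ĝ_{t−1} + r_t for a (possibly random) matrix B_t and remainder r_t, and ĝ_{t−1}ᵀ B_t ĝ_{t−1} ≥ λ_t ‖ĝ_{t−1}‖². Then for the projected bias b_t⊥ = P⊥_{t−1} b_t: E‖b_t⊥‖² ≤ E‖b_t‖² − η_{t−1}² λ_t² E‖ĝ_{t−1}‖² + 2 η_{t−1} λ_t E[‖ĝ_{t−1}‖ ‖r_t‖]. -/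
open MeasureTheory Classical
open scoped RealInnerProductSpace

/-- Removing the component of `b` along a unit vector `u` lowers the squared norm by the squared
coefficient. -/
theorem norm_sub_inner_smul_sq {E : Type*} [NormedAddCommGroup E] [InnerProductSpace ℝ E]
    (b : E) {u : E} (hu : ‖u‖ = 1) :
    ‖b - ⟪b, u⟫ • u‖ ^ 2 = ‖b‖ ^ 2 - ⟪b, u⟫ ^ 2 := by
  rw [norm_sub_sq_real, inner_smul_right, norm_smul, hu, mul_one, Real.norm_eq_abs, sq_abs]
  ring

/-- If `η • v + r` is a perturbation of a vector `η • v` positively correlated with `g`, then its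
component along `g` is at least `η * lam * ‖g‖ - ‖r‖`. -/
theorem le_inner_normalize_of_le_inner {E : Type*} [NormedAddCommGroup E] [InnerProductSpace ℝ E]
    {η lam : ℝ} (hη : 0 ≤ η) {g v r : E} (hg : g ≠ 0) (hv : lam * ‖g‖ ^ 2 ≤ ⟪g, v⟫) :
    η * lam * ‖g‖ - ‖r‖ ≤ ⟪η • v + r, ‖g‖⁻¹ • g⟫ := by
  have hpos : 0 < ‖g‖ := norm_pos_iff.mpr hg
  have hr : -(‖r‖ * ‖g‖) ≤ ⟪r, g⟫ := (abs_le.mp (abs_real_inner_le_norm r g)).1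
  have hηv := mul_le_mul_of_nonneg_left hv hη
  rw [inner_smul_right, inner_add_left, real_inner_smul_left, real_inner_comm, inv_mul_eq_div,
    le_div_iff₀ hpos]
  nlinarith

theorem sq_sub_two_mul_le_sq {a c ρ : ℝ} (ha : 0 ≤ a) (h : a - ρ ≤ c) :
    a ^ 2 - 2 * a * ρ ≤ c ^ 2 := by
  rcases le_total ρ a with hle | hle
  · nlinarith [pow_le_pow_left₀ (sub_nonneg.mpr hle) h 2, sq_nonneg ρ]
  · nlinarith [mul_le_mul_of_nonneg_left hle ha, mul_nonneg ha ha, sq_nonneg c]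

theorem stmt3 {d : ℕ} {Ω : Type*} [MeasurableSpace Ω] {μ : Measure Ω}
    [IsProbabilityMeasure μ]
    (η lam : ℝ) (hη : 0 < η) (hlam : 0 < lam)
    (g b r : Ω → EuclideanSpace ℝ (Fin d))
    (B : Ω → EuclideanSpace ℝ (Fin d) →ₗ[ℝ] EuclideanSpace ℝ (Fin d))
    (hb : ∀ᵐ ω ∂μ, b ω = η • B ω (g ω) + r ω)
    (hpers : ∀ᵐ ω ∂μ, lam * ‖g ω‖ ^ 2 ≤ ⟪g ω, B ω (g ω)⟫)
    (u : Ω → EuclideanSpace ℝ (Fin d))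
    (hu : ∀ ω, u ω = if g ω = 0 then 0 else ‖g ω‖⁻¹ • g ω)
    (bperp : Ω → EuclideanSpace ℝ (Fin d))
    (hbperp : ∀ ω, bperp ω = b ω - ⟪b ω, u ω⟫ • u ω)
    (hint1 : Integrable (fun ω => ‖bperp ω‖ ^ 2) μ)
    (hint2 : Integrable (fun ω => ‖b ω‖ ^ 2) μ)
    (hint3 : Integrable (fun ω => ‖g ω‖ ^ 2) μ)
    (hint4 : Integrable (fun ω => ‖g ω‖ * ‖r ω‖) μ) :
    ∫ ω, ‖bperp ω‖ ^ 2 ∂μ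
      ≤ (∫ ω, ‖b ω‖ ^ 2 ∂μ) - η ^ 2 * lam ^ 2 * ∫ ω, ‖g ω‖ ^ 2 ∂μ
        + 2 * η * lam * ∫ ω, ‖g ω‖ * ‖r ω‖ ∂μ := by
  have key : ∀ᵐ ω ∂μ, ‖bperp ω‖ ^ 2 ≤ ‖b ω‖ ^ 2 - η ^ 2 * lam ^ 2 * ‖g ω‖ ^ 2
      + 2 * η * lam * (‖g ω‖ * ‖r ω‖) := by
    filter_upwards [hb, hpers] with ω hbω hω
    rw [hbperp, hu]
    split_ifs with hg
    · simp [hg]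
    · rw [norm_sub_inner_smul_sq _ (by simpa using norm_smul_inv_norm (𝕜 := ℝ) hg)]
      have hc := le_inner_normalize_of_le_inner (r := r ω) hη.le hg hω
      rw [← hbω] at hc
      have hsq := sq_sub_two_mul_le_sq (by positivity) hc
      linarith
  have hint3' := hint3.const_mul (η ^ 2 * lam ^ 2)
  have hint4' := hint4.const_mul (2 * η * lam)
  calc ∫ ω, ‖bperp ω‖ ^ 2 ∂μ
      ≤ ∫ ω, (‖b ω‖ ^ 2 - η ^ 2 * lam ^ 2 * ‖g ω‖ ^ 2
          + 2 * η * lam * (‖g ω‖ * ‖r ω‖)) ∂μ :=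
        integral_mono_ae hint1 ((hint2.sub hint3').add hint4') key
    _ = _ := by
        rw [integral_add (by exact hint2.sub hint3') hint4', integral_sub hint2 hint3',
          integral_const_mul, integral_const_mul]
end

section
/- Under the hypotheses of the bias-reduction proposition (b_t = η_{t−1} B_t ĝ_{t−1} + r_t almost surely, ĝ_{t−1}ᵀ B_t ĝ_{t−1} ≥ λ_t ‖ĝ_{t−1}‖² almost surely with λ_t > 0, η_{t−1} > 0, b_t⊥ = P⊥_{t−1} b_t), if moreover E‖r_t‖² ≤ ε_t² for some ε_t ≥ 0, then E‖b_t⊥‖² ≤ E‖b_t‖² − η_{t−1}² λ_t² E‖ĝ_{t−1}‖² + 2 η_{t−1} λ_t ε_t √(E‖ĝ_{t−1}‖²). -/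
open MeasureTheory Classical
open scoped RealInnerProductSpace

/-- Cauchy–Schwarz for integrals of real functions whose squares and product are integrable. -/
theorem sq_integral_mul_le {Ω : Type*} [MeasurableSpace Ω] {μ : Measure Ω} {f h : Ω → ℝ}
    (hf : Integrable (fun ω => f ω ^ 2) μ) (hh : Integrable (fun ω => h ω ^ 2) μ)
    (hfh : Integrable (fun ω => f ω * h ω) μ) :
    (∫ ω, f ω * h ω ∂μ) ^ 2 ≤ (∫ ω, f ω ^ 2 ∂μ) * ∫ ω, h ω ^ 2 ∂μ := by
  have key : ∀ x : ℝ, 0 ≤ (∫ ω, f ω ^ 2 ∂μ) * (x * x) + (2 * ∫ ω, f ω * h ω ∂μ) * x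
      + ∫ ω, h ω ^ 2 ∂μ := by
    intro x
    have h0 : 0 ≤ ∫ ω, (f ω ^ 2 * (x * x) + f ω * h ω * (2 * x) + h ω ^ 2) ∂μ :=
      integral_nonneg fun ω => by
        change 0 ≤ f ω ^ 2 * (x * x) + f ω * h ω * (2 * x) + h ω ^ 2
        nlinarith [sq_nonneg (f ω * x + h ω)]
    have hsum : Integrable (fun ω => f ω ^ 2 * (x * x) + f ω * h ω * (2 * x)) μ :=
      (hf.mul_const _).add (hfh.mul_const _)
    rw [integral_add hsum hh,
      integral_add (hf.mul_const _) (hfh.mul_const _), integral_mul_const,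
      integral_mul_const] at h0
    linarith
  have := discrim_le_zero key
  rw [discrim] at this
  linarith

/-- Removing the component of `b` along the direction of `g` decreases the squared norm at least by
`c ^ 2 * ‖g‖ ^ 2`, up to the effect of the perturbation `r`. -/
theorem norm_sub_inner_smul_sq_le {E : Type*} [NormedAddCommGroup E] [InnerProductSpace ℝ E]
    {c : ℝ} (hc : 0 ≤ c) {g v r : E} [Decidable (g = 0)] (hv : c * ‖g‖ ^ 2 ≤ ⟪g, v⟫) {u : E}
    (hu : u = if g = 0 then 0 else ‖g‖⁻¹ • g) :
    ‖(v + r) - ⟪v + r, u⟫ • u‖ ^ 2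
      ≤ ‖v + r‖ ^ 2 - c ^ 2 * ‖g‖ ^ 2 + 2 * c * (‖g‖ * ‖r‖) := by
  by_cases hg : g = 0
  · simp [hu, hg]
  rw [if_neg hg] at hu
  have hpos : 0 < ‖g‖ := norm_pos_iff.mpr hg
  have hnu : ‖u‖ = 1 := by
    rw [hu, norm_smul, norm_inv, norm_norm, inv_mul_cancel₀ hpos.ne']
  have hvu : c * ‖g‖ ≤ ⟪v, u⟫ := by
    rw [hu, real_inner_smul_right, real_inner_comm, ← div_eq_inv_mul, le_div_iff₀ hpos]
    linarith
  have hru : -‖r‖ ≤ ⟪r, u⟫ := by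
    have h := abs_real_inner_le_norm r u
    rw [hnu, mul_one] at h
    exact (abs_le.mp h).1
  have hs : c * ‖g‖ - ‖r‖ ≤ ⟪v + r, u⟫ := by
    rw [inner_add_left]
    linarith
  have hexp : ‖(v + r) - ⟪v + r, u⟫ • u‖ ^ 2 = ‖v + r‖ ^ 2 - ⟪v + r, u⟫ ^ 2 := by
    rw [norm_sub_sq_real, real_inner_smul_right, norm_smul, hnu, mul_one, Real.norm_eq_abs, sq_abs]
    ring
  have ha : 0 ≤ c * ‖g‖ := by positivity
  have hr : 0 ≤ ‖r‖ := norm_nonneg r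
  rw [hexp]
  rcases le_total ‖r‖ (c * ‖g‖) with h | h
  · have := pow_le_pow_left₀ (sub_nonneg.mpr h) hs 2
    nlinarith
  · nlinarith [sq_nonneg ⟪v + r, u⟫, mul_nonneg ha (sub_nonneg.mpr h), mul_nonneg ha hr]

theorem stmt4 {d : ℕ} {Ω : Type*} [MeasurableSpace Ω] {μ : Measure Ω}
    [IsProbabilityMeasure μ]
    (η lam : ℝ) (hη : 0 < η) (hlam : 0 < lam)
    (g b r : Ω → EuclideanSpace ℝ (Fin d))
    (B : Ω → EuclideanSpace ℝ (Fin d) →ₗ[ℝ] EuclideanSpace ℝ (Fin d))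
    (hb : ∀ᵐ ω ∂μ, b ω = η • B ω (g ω) + r ω)
    (hpers : ∀ᵐ ω ∂μ, lam * ‖g ω‖ ^ 2 ≤ ⟪g ω, B ω (g ω)⟫)
    (u : Ω → EuclideanSpace ℝ (Fin d))
    (hu : ∀ ω, u ω = if g ω = 0 then 0 else ‖g ω‖⁻¹ • g ω)
    (bperp : Ω → EuclideanSpace ℝ (Fin d))
    (hbperp : ∀ ω, bperp ω = b ω - ⟪b ω, u ω⟫ • u ω)
    (hint1 : Integrable (fun ω => ‖bperp ω‖ ^ 2) μ)
    (hint2 : Integrable (fun ω => ‖b ω‖ ^ 2) μ)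
    (hint3 : Integrable (fun ω => ‖g ω‖ ^ 2) μ)
    (hint4 : Integrable (fun ω => ‖g ω‖ * ‖r ω‖) μ)
    (hint5 : Integrable (fun ω => ‖r ω‖ ^ 2) μ)
    (ε : ℝ) (hε : 0 ≤ ε) (hr : ∫ ω, ‖r ω‖ ^ 2 ∂μ ≤ ε ^ 2) :
    ∫ ω, ‖bperp ω‖ ^ 2 ∂μ
      ≤ (∫ ω, ‖b ω‖ ^ 2 ∂μ) - η ^ 2 * lam ^ 2 * ∫ ω, ‖g ω‖ ^ 2 ∂μ
        + 2 * η * lam * ε * Real.sqrt (∫ ω, ‖g ω‖ ^ 2 ∂μ) := by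
  have hdiff : Integrable (fun ω => ‖b ω‖ ^ 2 - (η * lam) ^ 2 * ‖g ω‖ ^ 2) μ :=
    hint2.sub (hint3.const_mul _)
  have hmono : ∫ ω, ‖bperp ω‖ ^ 2 ∂μ ≤ ∫ ω, (‖b ω‖ ^ 2 - (η * lam) ^ 2 * ‖g ω‖ ^ 2
      + 2 * (η * lam) * (‖g ω‖ * ‖r ω‖)) ∂μ := by
    refine integral_mono_ae hint1 (hdiff.add (hint4.const_mul _)) ?_
    filter_upwards [hb, hpers] with ω hbω hpω
    have hv : η * lam * ‖g ω‖ ^ 2 ≤ ⟪g ω, η • B ω (g ω)⟫ := by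
      rw [real_inner_smul_right, mul_assoc]
      exact mul_le_mul_of_nonneg_left hpω hη.le
    rw [hbperp ω, hbω]
    exact norm_sub_inner_smul_sq_le (by positivity) hv (hu ω)
  rw [integral_add hdiff (hint4.const_mul _),
    integral_sub hint2 (hint3.const_mul _), integral_const_mul, integral_const_mul] at hmono
  have hG : 0 ≤ ∫ ω, ‖g ω‖ ^ 2 ∂μ := integral_nonneg fun ω => sq_nonneg _
  have hcs : ∫ ω, ‖g ω‖ * ‖r ω‖ ∂μ ≤ ε * Real.sqrt (∫ ω, ‖g ω‖ ^ 2 ∂μ) := by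
    refine le_of_abs_le (abs_le_of_sq_le_sq ?_ (by positivity))
    rw [mul_pow, Real.sq_sqrt hG, mul_comm (ε ^ 2)]
    exact (sq_integral_mul_le hint3 hint5 hint4).trans (mul_le_mul_of_nonneg_left hr hG)
  have := mul_le_mul_of_nonneg_left hcs (by positivity : 0 ≤ 2 * (η * lam))
  linarith
end

section
/- GAC projection reduces cosine alignment: let ĝ_{t−1}, ĝ_t ∈ ℝ^d be nonzero, u = ĝ_{t−1}/‖ĝ_{t−1}‖, and c_t = ⟨ĝ_t, ĝ_{t−1}⟩/(‖ĝ_t‖‖ĝ_{t−1}‖) with 0 < c_low < |c_t| < 1. Define the projected gradient ĝ_t' = (c_low/|c_t|)⟨ĝ_t, u⟩u + (ĝ_t − ⟨ĝ_t, u⟩u). Then ĝ_t' ≠ 0, its cosine similarity with ĝ_{t−1} satisfies |⟨ĝ_t', ĝ_{t−1}⟩|/(‖ĝ_t'‖‖ĝ_{t−1}‖) = c_low/√(1 + c_low² − c_t²), and this quantity is at most |c_t|. -/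
open scoped RealInnerProductSpace

section ScaleAlong

variable {E : Type*} [NormedAddCommGroup E] [InnerProductSpace ℝ E]

/-- Rescaling the component of `x` along a unit vector `u` by `k` rescales its inner product
with `u` by `k`. -/
lemma inner_scale_along_unit {u : E} (hu : ‖u‖ = 1) (x : E) (k : ℝ) :
    ⟪k • (⟪x, u⟫ • u) + (x - ⟪x, u⟫ • u), u⟫ = k * ⟪x, u⟫ := by
  simp only [inner_add_left, inner_sub_left, real_inner_smul_left,
    real_inner_self_eq_norm_sq, hu]
  ring

/-- The squared norm after rescaling the component of `x` along a unit vector `u` by `k`. -/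
lemma norm_sq_scale_along_unit {u : E} (hu : ‖u‖ = 1) (x : E) (k : ℝ) :
    ‖k • (⟪x, u⟫ • u) + (x - ⟪x, u⟫ • u)‖ ^ 2 = ‖x‖ ^ 2 + (k ^ 2 - 1) * ⟪x, u⟫ ^ 2 := by
  simp only [← real_inner_self_eq_norm_sq, inner_add_left, inner_sub_left, inner_add_right,
    inner_sub_right, real_inner_smul_left, real_inner_smul_right, real_inner_comm x u]
  rw [real_inner_self_eq_norm_sq u, hu]
  ring

end ScaleAlong

/-- Lowering a cosine from `|c|` to `a / √(1 + a² - c²)` does not increase it. -/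
lemma div_sqrt_one_add_sq_sub_sq_le {a c : ℝ} (ha : 0 < a) (hac : a < |c|) (hc : |c| < 1) :
    a / √(1 + a ^ 2 - c ^ 2) ≤ |c| := by
  have hc2 : |c| ^ 2 < 1 := pow_lt_one₀ (abs_nonneg c) hc two_ne_zero
  have hac2 : a ^ 2 ≤ |c| ^ 2 := pow_le_pow_left₀ ha.le hac.le 2
  rw [← sq_abs c]
  have hD : 0 < 1 + a ^ 2 - |c| ^ 2 := by nlinarith [sq_nonneg a]
  rw [div_le_iff₀ (Real.sqrt_pos.2 hD)]
  refine (sq_le_sq₀ ha.le (by positivity)).1 ?_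
  rw [mul_pow, Real.sq_sqrt hD.le]
  nlinarith [mul_nonneg (sub_nonneg.2 hac2) (sub_nonneg.2 hc2.le)]

theorem stmt12 {d : ℕ} (gprev gcur : EuclideanSpace ℝ (Fin d))
    (hprev : gprev ≠ 0) (hcur : gcur ≠ 0)
    (u : EuclideanSpace ℝ (Fin d)) (hu : u = ‖gprev‖⁻¹ • gprev)
    (c clow : ℝ) (hc : c = ⟪gcur, gprev⟫ / (‖gcur‖ * ‖gprev‖))
    (h1 : 0 < clow) (h2 : clow < |c|) (h3 : |c| < 1)
    (g' : EuclideanSpace ℝ (Fin d))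
    (hg' : g' = (clow / |c|) • (⟪gcur, u⟫ • u) + (gcur - ⟪gcur, u⟫ • u)) :
    g' ≠ 0 ∧
      |⟪g', gprev⟫| / (‖g'‖ * ‖gprev‖) = clow / Real.sqrt (1 + clow ^ 2 - c ^ 2) ∧
      clow / Real.sqrt (1 + clow ^ 2 - c ^ 2) ≤ |c| := by
  have hP : 0 < ‖gprev‖ := norm_pos_iff.2 hprev
  have hN : 0 < ‖gcur‖ := norm_pos_iff.2 hcur
  have hc0 : 0 < |c| := h1.trans h2
  have hc2 : c ^ 2 < 1 := (sq_lt_one_iff_abs_lt_one c).2 h3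
  have hD : 0 < 1 + clow ^ 2 - c ^ 2 := by nlinarith [sq_nonneg clow]
  have hu1 : ‖u‖ = 1 := by rw [hu]; exact norm_smul_inv_norm hprev
  have hgprev : gprev = ‖gprev‖ • u := by rw [hu, smul_inv_smul₀ hP.ne']
  have ha : ⟪gcur, u⟫ = c * ‖gcur‖ := by
    rw [hu, hc, real_inner_smul_right]; field_simp
  have hin : ⟪g', gprev⟫ = ‖gprev‖ * (clow / |c| * (c * ‖gcur‖)) := by
    rw [hgprev, real_inner_smul_right, hg', inner_scale_along_unit hu1, ha, ← hgprev]
  have habs : |⟪g', gprev⟫| = ‖gprev‖ * (clow * ‖gcur‖) := by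
    rw [hin, abs_mul, abs_mul, abs_mul, abs_div, abs_abs, abs_norm, abs_norm, abs_of_pos h1]
    field_simp
  have hnorm : ‖g'‖ = ‖gcur‖ * √(1 + clow ^ 2 - c ^ 2) := by
    refine (sq_eq_sq₀ (norm_nonneg _) (by positivity)).1 ?_
    rw [hg', norm_sq_scale_along_unit hu1, ha, mul_pow, mul_pow, Real.sq_sqrt hD.le, div_pow, sq_abs]
    have := abs_pos.1 hc0
    field_simp
    ring
  have hS := Real.sqrt_pos.2 hD
  refine ⟨norm_pos_iff.1 (hnorm ▸ mul_pos hN hS), ?_, div_sqrt_one_add_sq_sub_sq_le h1 h2 h3⟩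
  rw [habs, hnorm]
  field_simp
end
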